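/- arXiv:2003.02009 — 2 statements merged into one kernel-verified Lean document; each statement's English description precedes it below -/
import Mathlib

section
/- Let p be prime, n ≥ 1, let α₁, α₂ ∈ ℝ with α = α₁ + α₂, let 1 < q₁, q₂ < ∞ with 1/q = 1/q₁ + 1/q₂ and 1 < q, let 1 < r < ∞, let 0 < ε < 1, and let ψ be a nonnegative measurable function on ℤ_p^* × ℤ_p^*. Define f_i on ℚ_p^n by f_i(x) = |x|_p^{−α_i−n/q_i−ε} if |x|_p ≥ 1 and f_i(x) = 0 otherwise. Then for every integer l ≥ 0, ‖H^{p,2}_ψ(f₁,f₂)‖_{K̇^{α,r}_q} ≥ (1 − p^{−n})^{1/q} · p^{2ε} (p^{2εr} − 1)^{−1/r} · p^{−2lε} · ∫∫_{{(t₁,t₂) : p^{−l} ≤ |t₁|_p ≤ 1, p^{−l} ≤ |t₂|_p ≤ 1}} |t₁|_p^{−α₁−n/q₁−ε} |t₂|_p^{−α₂−n/q₂−ε} ψ(t₁,t₂) dt₁ dt₂. -/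
open MeasureTheory
open scoped ENNReal

noncomputable section

variable (p : ℕ) [Fact p.Prime]

instance padicMeasurableSpace : MeasurableSpace ℚ_[p] := borel _
instance padicBorelSpace : BorelSpace ℚ_[p] := ⟨rfl⟩

/-- The closed unit ball of `ℚ_[p]` as a positive compact set. -/
def padicUnitBall : TopologicalSpace.PositiveCompacts ℚ_[p] where
  carrier := Metric.closedBall 0 1
  isCompact' := isCompact_closedBall 0 1
  interior_nonempty' :=
    ⟨0, mem_interior_iff_mem_nhds.mpr
      (Filter.mem_of_superset (Metric.ball_mem_nhds 0 one_pos) Metric.ball_subset_closedBall)⟩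

/-- Haar measure on `ℚ_[p]` normalized so that `ℤ_p` has measure 1. -/
def padicHaar : Measure ℚ_[p] := Measure.addHaarMeasure (padicUnitBall p)

instance : SigmaFinite (padicHaar p) := by
  unfold padicHaar; infer_instance

/-- Normalized Haar measure on `ℚ_[p]^n` (the product measure), for which the
unit ball has measure 1. -/
def padicHaarPi (n : ℕ) : Measure (Fin n → ℚ_[p]) := Measure.pi fun _ => padicHaar p

/-- `ℤ_p^* = {t : 0 < |t|_p ≤ 1}`. -/
def Zpstar : Set ℚ_[p] := {t | t ≠ 0 ∧ ‖t‖ ≤ 1}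

/-- `(ℤ_p^*)^m`. -/
def ZpstarPi (m : ℕ) : Set (Fin m → ℚ_[p]) := Set.univ.pi fun _ => Zpstar p

/-- The sphere `S_k = {x ∈ ℚ_p^n : |x|_p = p^k}`. -/
def padicSphere (n : ℕ) (k : ℤ) : Set (Fin n → ℚ_[p]) := {x | ‖x‖ = (p : ℝ) ^ k}

/-- `‖f χ_k‖_{L^q}` for a nonnegative (ℝ≥0∞-valued) function. -/
def lqNormSphere (n : ℕ) (q : ℝ) (k : ℤ) (f : (Fin n → ℚ_[p]) → ℝ≥0∞) : ℝ≥0∞ :=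
  (∫⁻ x in padicSphere p n k, f x ^ q ∂ padicHaarPi p n) ^ (1 / q)

/-- The homogeneous p-adic Herz norm `‖f‖_{K̇^{α,r}_q}`. -/
def herzNorm (n : ℕ) (α r q : ℝ) (f : (Fin n → ℚ_[p]) → ℝ≥0∞) : ℝ≥0∞ :=
  (∑' k : ℤ, (p : ℝ≥0∞) ^ ((k : ℝ) * α * r) * lqNormSphere p n q k f ^ r) ^ (1 / r)

/-- The homogeneous p-adic Morrey–Herz norm `‖f‖_{MK̇^{α,λ}_{r,q}}`. -/
def morreyHerzNorm (n : ℕ) (α lam r q : ℝ) (f : (Fin n → ℚ_[p]) → ℝ≥0∞) : ℝ≥0∞ :=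
  ⨆ k₀ : ℤ, (p : ℝ≥0∞) ^ (-(k₀ : ℝ) * lam) *
    (∑' k : {k : ℤ // k ≤ k₀},
      (p : ℝ≥0∞) ^ (((k : ℤ) : ℝ) * α * r) * lqNormSphere p n q (k : ℤ) f ^ r) ^ (1 / r)

/-- The weighted multilinear p-adic Hardy operator `H^{p,m}_ψ`. -/
def multilinearHardy (n m : ℕ) (ψ : (Fin m → ℚ_[p]) → ℝ≥0∞)
    (f : Fin m → (Fin n → ℚ_[p]) → ℝ≥0∞) (x : Fin n → ℚ_[p]) : ℝ≥0∞ :=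
  ∫⁻ t in ZpstarPi p m, (∏ i, f i (t i • x)) * ψ t ∂ padicHaarPi p m

/-- The dual weighted multilinear p-adic Hardy operator `H^{p,m,*}_ψ`. -/
def multilinearHardyDual (n m : ℕ) (ψ : (Fin m → ℚ_[p]) → ℝ≥0∞)
    (f : Fin m → (Fin n → ℚ_[p]) → ℝ≥0∞) (x : Fin n → ℚ_[p]) : ℝ≥0∞ :=
  ∫⁻ t in ZpstarPi p m,
      (∏ i, f i ((((padicNormE (t i) : ℚ)⁻¹ : ℚ_[p])) • x)) *
        (∏ i, ENNReal.ofReal ‖t i‖ ^ (-(n : ℝ))) * ψ t ∂ padicHaarPi p m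


open Set in
theorem padicHaar_closedBall_zpow_succ (p : ℕ) [Fact p.Prime] (k : ℤ) :
    padicHaar p (Metric.closedBall 0 ((p : ℝ) ^ (k + 1))) =
      p * padicHaar p (Metric.closedBall 0 ((p : ℝ) ^ k)) := by
  have hppos : (0 : ℝ) < p := mod_cast (Fact.out : p.Prime).pos
  have hpq : (p : ℚ_[p]) ≠ 0 := mod_cast (Fact.out : p.Prime).ne_zero
  have hscale : ∀ z : ℚ_[p], ‖z * (p : ℚ_[p]) ^ (k + 1)‖ = ‖z‖ * ((p : ℝ) ^ (k + 1))⁻¹ := by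
    intro z
    rw [norm_mul, norm_zpow, Padic.norm_p, inv_zpow]
  have hmem : ∀ (i : ℕ) (z : ℚ_[p]),
      z ∈ Metric.closedBall ((i : ℚ_[p]) * (p : ℚ_[p]) ^ (-(k + 1))) ((p : ℝ) ^ k) ↔
        ‖z * (p : ℚ_[p]) ^ (k + 1) - i‖ < 1 := by
    intro i z
    rw [mem_closedBall_iff_norm, Padic.norm_le_pow_iff_norm_lt_pow_add_one]
    have h : z * (p : ℚ_[p]) ^ (k + 1) - i =
        (z - (i : ℚ_[p]) * (p : ℚ_[p]) ^ (-(k + 1))) * (p : ℚ_[p]) ^ (k + 1) := by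
      rw [sub_mul, mul_assoc, ← zpow_add₀ hpq, neg_add_cancel, zpow_zero, mul_one]
    rw [h, hscale, ← div_eq_mul_inv, div_lt_one (zpow_pos hppos _)]
  have hle : ∀ z : ℚ_[p], z ∈ Metric.closedBall (0 : ℚ_[p]) ((p : ℝ) ^ (k + 1)) ↔
      ‖z * (p : ℚ_[p]) ^ (k + 1)‖ ≤ 1 := by
    intro z
    rw [mem_closedBall_zero_iff, hscale, ← div_eq_mul_inv, div_le_one (zpow_pos hppos _)]
  have hideal : ∀ (z : ℚ_[p]) (hz : ‖z * (p : ℚ_[p]) ^ (k + 1)‖ ≤ 1) (m : ℕ),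
      (show ℤ_[p] from ⟨_, hz⟩) - m ∈ IsLocalRing.maximalIdeal ℤ_[p] ↔
        ‖z * (p : ℚ_[p]) ^ (k + 1) - m‖ < 1 := by
    intro z hz m
    rw [PadicInt.maximalIdeal_eq_span_p, Ideal.mem_span_singleton,
      ← PadicInt.norm_lt_one_iff_dvd, PadicInt.norm_def, PadicInt.coe_sub, PadicInt.coe_natCast]
  have hunion : Metric.closedBall (0 : ℚ_[p]) ((p : ℝ) ^ (k + 1)) =
      ⋃ i ∈ Finset.range p,
        Metric.closedBall ((i : ℚ_[p]) * (p : ℚ_[p]) ^ (-(k + 1))) ((p : ℝ) ^ k) := by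
    ext z
    simp only [mem_iUnion, hmem, hle, Finset.mem_range, exists_prop]
    constructor
    · intro hz
      obtain ⟨i, hi, hzi⟩ := PadicInt.exists_mem_range (p := p) ⟨_, hz⟩
      exact ⟨i, hi, (hideal z hz i).mp hzi⟩
    · rintro ⟨i, -, hzi⟩
      have h1 : ‖(i : ℚ_[p])‖ ≤ 1 := mod_cast Padic.norm_int_le_one (p := p) (i : ℤ)
      calc _ = ‖(z * (p : ℚ_[p]) ^ (k + 1) - i) + i‖ := by rw [sub_add_cancel]
        _ ≤ _ := (Padic.nonarchimedean _ _).trans (max_le hzi.le h1)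
  have hdisj : Set.PairwiseDisjoint (Finset.range p : Set ℕ) fun i : ℕ =>
      Metric.closedBall ((i : ℚ_[p]) * (p : ℚ_[p]) ^ (-(k + 1))) ((p : ℝ) ^ k) := by
    intro i hi j hj hij
    refine Set.disjoint_left.mpr fun z hzi hzj => hij ?_
    have hzi' := (hmem i z).mp hzi
    have hzj' := (hmem j z).mp hzj
    have hz : ‖z * (p : ℚ_[p]) ^ (k + 1)‖ ≤ 1 := by
      refine (hle z).mp ?_
      rw [hunion]
      exact mem_iUnion₂.mpr ⟨i, hi, hzi⟩
    exact (PadicInt.existsUnique_mem_range (p := p) ⟨_, hz⟩).unique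
      ⟨Finset.mem_range.mp hi, (hideal z hz i).mpr hzi'⟩ ⟨Finset.mem_range.mp hj, (hideal z hz j).mpr hzj'⟩
  have htrans : ∀ c : ℚ_[p], padicHaar p (Metric.closedBall c ((p : ℝ) ^ k)) =
      padicHaar p (Metric.closedBall 0 ((p : ℝ) ^ k)) := by
    intro c
    unfold padicHaar
    rw [← measure_preimage_add _ c (Metric.closedBall c ((p : ℝ) ^ k))]
    congr 1
    ext z
    simp
  rw [hunion, measure_biUnion_finset hdisj fun _ _ => measurableSet_closedBall]
  simp [htrans]

theorem padicHaar_closedBall_zpow (p : ℕ) [Fact p.Prime] (k : ℤ) :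
    padicHaar p (Metric.closedBall 0 ((p : ℝ) ^ k)) = (p : ℝ≥0∞) ^ (k : ℝ) := by
  have hp0 : (p : ℝ≥0∞) ≠ 0 := mod_cast (Fact.out : p.Prime).ne_zero
  have hptop : (p : ℝ≥0∞) ≠ ∞ := ENNReal.natCast_ne_top p
  induction k using Int.induction_on with
  | zero =>
    simp only [zpow_zero, Int.cast_zero, ENNReal.rpow_zero]
    exact Measure.addHaarMeasure_self (K₀ := padicUnitBall p)
  | succ k ih =>
    rw [padicHaar_closedBall_zpow_succ, ih, Int.cast_add, ENNReal.rpow_add _ _ hp0 hptop,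
      mul_comm]
    simp
  | pred k ih =>
    have h := padicHaar_closedBall_zpow_succ p (-(k : ℤ) - 1)
    rw [sub_add_cancel, ih] at h
    have h2 : (p : ℝ≥0∞) ^ (((-(k : ℤ) : ℤ)) : ℝ) =
        p * (p : ℝ≥0∞) ^ (((-(k : ℤ) - 1 : ℤ)) : ℝ) := by
      conv_rhs => enter [1]; rw [← ENNReal.rpow_one (p : ℝ≥0∞)]
      rw [← ENNReal.rpow_add _ _ hp0 hptop]
      push_cast
      congr 1
      ring
    rw [h2] at h
    exact ((ENNReal.mul_right_inj hp0 hptop).mp h).symm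

theorem padicHaarPi_closedBall_zpow (p n : ℕ) [Fact p.Prime] (k : ℤ) :
    padicHaarPi p n (Metric.closedBall 0 ((p : ℝ) ^ k)) = (p : ℝ≥0∞) ^ ((k : ℝ) * n) := by
  have hppos : (0 : ℝ) < p := mod_cast (Fact.out : p.Prime).pos
  rw [closedBall_pi _ (zpow_pos hppos k).le, padicHaarPi, Measure.pi_pi]
  simp [padicHaar_closedBall_zpow, ENNReal.rpow_mul]

theorem measurableSet_padicSphere (p n : ℕ) [Fact p.Prime] (k : ℤ) :
    MeasurableSet (padicSphere p n k) :=
  (isClosed_eq continuous_norm continuous_const).measurableSet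

theorem padicHaarPi_padicSphere (p n : ℕ) [Fact p.Prime] (k : ℤ) :
    padicHaarPi p n (padicSphere p n k) =
      (p : ℝ≥0∞) ^ ((k : ℝ) * n) * (1 - (p : ℝ≥0∞) ^ (-(n : ℝ))) := by
  have hp1 : (1 : ℝ) < p := mod_cast (Fact.out : p.Prime).one_lt
  have hppos : (0 : ℝ) < p := one_pos.trans hp1
  have hp0 : (p : ℝ≥0∞) ≠ 0 := mod_cast (Fact.out : p.Prime).ne_zero
  have hptop : (p : ℝ≥0∞) ≠ ∞ := ENNReal.natCast_ne_top p
  have hset : padicSphere p n k = Metric.closedBall (0 : Fin n → ℚ_[p]) ((p : ℝ) ^ k) \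
      Metric.closedBall 0 ((p : ℝ) ^ (k - 1)) := by
    ext x
    have hlt : ‖x‖ ≤ (p : ℝ) ^ (k - 1) ↔ ‖x‖ < (p : ℝ) ^ k := by
      rw [pi_norm_le_iff_of_nonneg (zpow_pos hppos _).le, pi_norm_lt_iff (zpow_pos hppos _)]
      exact forall_congr' fun i => (Padic.norm_lt_pow_iff_norm_le_pow_sub_one _ _).symm
    simp only [padicSphere, Set.mem_ofPred_eq, Set.mem_sdiff, mem_closedBall_zero_iff, hlt,
      not_lt]
    exact le_antisymm_iff
  have hfin : ∀ x : ℝ, (p : ℝ≥0∞) ^ x ≠ ∞ := fun x =>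
    ENNReal.rpow_ne_top_of_ne_zero hp0 hptop
  rw [hset, measure_sdiff (Metric.closedBall_subset_closedBall
      (zpow_le_zpow_right₀ hp1.le (by lia))) measurableSet_closedBall.nullMeasurableSet
      (by rw [padicHaarPi_closedBall_zpow]; exact hfin _),
    padicHaarPi_closedBall_zpow, padicHaarPi_closedBall_zpow,
    ENNReal.mul_sub fun _ _ => hfin _, mul_one, ← ENNReal.rpow_add _ _ hp0 hptop]
  congr 2
  push_cast
  ring

/-- Lower bound for the Herz norm of a function bounded below by a power of the norm outside a
ball. -/
theorem le_herzNorm_of_rpow_le (p n : ℕ) [Fact p.Prime] {α q r δ : ℝ} (hq : 0 < q) (hr : 0 < r)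
    (l : ℤ) (c : ℝ≥0∞) (g : (Fin n → ℚ_[p]) → ℝ≥0∞)
    (hg : ∀ k : ℤ, l ≤ k → ∀ x ∈ padicSphere p n k,
      (p : ℝ≥0∞) ^ ((k : ℝ) * (-α - n / q - δ)) * c ≤ g x) :
    (1 - (p : ℝ≥0∞) ^ (-(n : ℝ))) ^ (1 / q) * (p : ℝ≥0∞) ^ δ *
        ((p : ℝ≥0∞) ^ (δ * r) - 1) ^ (-(1 / r)) * (p : ℝ≥0∞) ^ (-((l : ℝ) * δ)) * c
      ≤ herzNorm p n α r q g := by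
  have hp0 : (p : ℝ≥0∞) ≠ 0 := mod_cast (Fact.out : p.Prime).ne_zero
  have hptop : (p : ℝ≥0∞) ≠ ∞ := ENNReal.natCast_ne_top p
  have hfin : ∀ x : ℝ, (p : ℝ≥0∞) ^ x ≠ ∞ := fun x =>
    ENNReal.rpow_ne_top_of_ne_zero hp0 hptop
  set D : ℝ≥0∞ := (1 - (p : ℝ≥0∞) ^ (-(n : ℝ))) ^ (1 / q)
  have hsphere : ∀ k : ℤ, l ≤ k →
      (p : ℝ≥0∞) ^ ((k : ℝ) * (-α - δ)) * (D * c) ≤ lqNormSphere p n q k g := by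
    intro k hk
    calc (p : ℝ≥0∞) ^ ((k : ℝ) * (-α - δ)) * (D * c)
        = ((p : ℝ≥0∞) ^ ((k : ℝ) * (-α - n / q - δ)) * c) *
            ((p : ℝ≥0∞) ^ ((k : ℝ) * n * (1 / q)) * D) := by
          rw [mul_mul_mul_comm, ← ENNReal.rpow_add _ _ hp0 hptop, mul_comm c D]
          congr 2
          ring
      _ = (∫⁻ _ in padicSphere p n k,
            ((p : ℝ≥0∞) ^ ((k : ℝ) * (-α - n / q - δ)) * c) ^ q ∂padicHaarPi p n) ^ (1 / q) := by
          rw [setLIntegral_const, ENNReal.mul_rpow_of_nonneg _ _ (one_div_pos.mpr hq).le,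
            ← ENNReal.rpow_mul, mul_one_div_cancel hq.ne', ENNReal.rpow_one,
            padicHaarPi_padicSphere, ENNReal.mul_rpow_of_nonneg _ _ (one_div_pos.mpr hq).le,
            ← ENNReal.rpow_mul]
      _ ≤ lqNormSphere p n q k g := by
          refine ENNReal.rpow_le_rpow ?_ (one_div_pos.mpr hq).le
          exact setLIntegral_mono' (measurableSet_padicSphere p n k) fun x hx =>
            ENNReal.rpow_le_rpow (hg k hk x hx) hq.le
  have hterm : ∀ j : ℕ, ((p : ℝ≥0∞) ^ (-((l : ℝ) * δ)) * (D * c)) ^ r *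
        ((p : ℝ≥0∞) ^ (-(δ * r))) ^ j ≤
      (p : ℝ≥0∞) ^ (((l + j : ℤ) : ℝ) * α * r) * lqNormSphere p n q (l + j) g ^ r := by
    intro j
    refine le_trans (le_of_eq ?_) (mul_le_mul_right
      (ENNReal.rpow_le_rpow (hsphere (l + j) (by lia)) hr.le) _)
    generalize D * c = e
    rw [ENNReal.mul_rpow_of_nonneg _ _ hr.le, ENNReal.mul_rpow_of_nonneg _ _ hr.le,
      ← ENNReal.rpow_mul, ← ENNReal.rpow_mul, ← mul_assoc, ← ENNReal.rpow_natCast,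
      ← ENNReal.rpow_mul, mul_right_comm, ← ENNReal.rpow_add _ _ hp0 hptop,
      ← ENNReal.rpow_add _ _ hp0 hptop]
    congr 2
    push_cast
    ring
  have hgeom : (1 - (p : ℝ≥0∞) ^ (-(δ * r)))⁻¹ =
      (p : ℝ≥0∞) ^ (δ * r) * ((p : ℝ≥0∞) ^ (δ * r) - 1)⁻¹ := by
    have h : (p : ℝ≥0∞) ^ (δ * r) - 1 =
        (p : ℝ≥0∞) ^ (δ * r) * (1 - (p : ℝ≥0∞) ^ (-(δ * r))) := by
      rw [ENNReal.mul_sub fun _ _ => hfin _, mul_one, ← ENNReal.rpow_add _ _ hp0 hptop,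
        add_neg_cancel, ENNReal.rpow_zero]
    have hne : (p : ℝ≥0∞) ^ (δ * r) ≠ 0 := (ENNReal.rpow_pos (pos_iff_ne_zero.mpr hp0) hptop).ne'
    rw [h, ENNReal.mul_inv (Or.inl hne) (Or.inl (hfin _)), ← mul_assoc,
      ENNReal.mul_inv_cancel hne (hfin _), one_mul]
  have hsum := (ENNReal.tsum_le_tsum hterm).trans
    (ENNReal.tsum_comp_le_tsum_of_injective (f := fun j : ℕ => l + (j : ℤ))
      (fun a b h => by simpa using h)
      fun k : ℤ => (p : ℝ≥0∞) ^ ((k : ℝ) * α * r) * lqNormSphere p n q k g ^ r)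
  rw [ENNReal.tsum_mul_left, ENNReal.tsum_geometric, hgeom] at hsum
  have hr' : 0 ≤ 1 / r := (one_div_pos.mpr hr).le
  refine le_trans (le_of_eq ?_) (ENNReal.rpow_le_rpow hsum hr')
  rw [ENNReal.mul_rpow_of_nonneg _ _ hr', ENNReal.mul_rpow_of_nonneg _ _ hr',
    ← ENNReal.rpow_mul, ← ENNReal.rpow_mul, mul_one_div_cancel hr.ne', ENNReal.rpow_one,
    mul_assoc δ r, mul_one_div_cancel hr.ne', mul_one, ENNReal.inv_rpow, ENNReal.rpow_neg]
  ring

/-- The lower bound for the Herz norm of `H^{p,2}_ψ(f₁,f₂)` at the test functions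
`f_i(x) = |x|_p^{-α_i-n/q_i-ε}` (for `|x|_p ≥ 1`, and `0` otherwise), used in the
necessity part of Theorem 2.1. -/
theorem statement11 (p n : ℕ) [Fact p.Prime] (hn : 1 ≤ n)
    (α α₁ α₂ q q₁ q₂ r ε : ℝ) (hα : α = α₁ + α₂)
    (hq₁ : 1 < q₁) (hq₂ : 1 < q₂) (hqs : 1 / q = 1 / q₁ + 1 / q₂) (hq : 1 < q)
    (hr : 1 < r) (hε0 : 0 < ε) (hε1 : ε < 1)
    (ψ : (Fin 2 → ℚ_[p]) → ℝ≥0∞) (hψ : Measurable ψ)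
    (f₁ f₂ : (Fin n → ℚ_[p]) → ℝ≥0∞)
    (hf₁ : ∀ x, f₁ x = if 1 ≤ ‖x‖ then
        ENNReal.ofReal ‖x‖ ^ (-α₁ - (n : ℝ) / q₁ - ε) else 0)
    (hf₂ : ∀ x, f₂ x = if 1 ≤ ‖x‖ then
        ENNReal.ofReal ‖x‖ ^ (-α₂ - (n : ℝ) / q₂ - ε) else 0) :
    ∀ l : ℤ, 0 ≤ l →
      (1 - (p : ℝ≥0∞) ^ (-(n : ℝ))) ^ (1 / q) * (p : ℝ≥0∞) ^ (2 * ε) *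
          ((p : ℝ≥0∞) ^ (2 * ε * r) - 1) ^ (-(1 / r)) *
          (p : ℝ≥0∞) ^ (-(2 * (l : ℝ) * ε)) *
          ∫⁻ t in {t : Fin 2 → ℚ_[p] | ∀ i, (p : ℝ) ^ (-l) ≤ ‖t i‖ ∧ ‖t i‖ ≤ 1},
            ENNReal.ofReal ‖t 0‖ ^ (-α₁ - (n : ℝ) / q₁ - ε) *
              ENNReal.ofReal ‖t 1‖ ^ (-α₂ - (n : ℝ) / q₂ - ε) * ψ t ∂ padicHaarPi p 2
        ≤ herzNorm p n α r q (multilinearHardy p n 2 ψ ![f₁, f₂]) := by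
  intro l hl
  have hppos : (0 : ℝ) < p := mod_cast (Fact.out : p.Prime).pos
  have hp0 : (p : ℝ≥0∞) ≠ 0 := mod_cast (Fact.out : p.Prime).ne_zero
  have hptop : (p : ℝ≥0∞) ≠ ∞ := ENNReal.natCast_ne_top p
  have hfin : ∀ x : ℝ, (p : ℝ≥0∞) ^ x ≠ ∞ := fun x =>
    ENNReal.rpow_ne_top_of_ne_zero hp0 hptop
  have hofReal : ∀ k : ℤ, ENNReal.ofReal ((p : ℝ) ^ k) = (p : ℝ≥0∞) ^ (k : ℝ) := fun k => by
    rw [← Real.rpow_intCast, ← ENNReal.ofReal_rpow_of_pos hppos, ENNReal.ofReal_natCast]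
  rw [show 2 * (l : ℝ) * ε = (l : ℝ) * (2 * ε) by ring]
  refine le_herzNorm_of_rpow_le p n (one_pos.trans hq) (one_pos.trans hr) l _ _ fun k hk x hx => ?_
  have hx' : ‖x‖ = (p : ℝ) ^ k := hx
  set A : Set (Fin 2 → ℚ_[p]) := {t | ∀ i, (p : ℝ) ^ (-l) ≤ ‖t i‖ ∧ ‖t i‖ ≤ 1} with hA
  have hAmeas : MeasurableSet A := by
    rw [hA, Set.ofPred_forall]
    refine MeasurableSet.iInter fun i => IsClosed.measurableSet ?_
    exact (isClosed_le continuous_const (continuous_apply i).norm).inter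
      (isClosed_le (continuous_apply i).norm continuous_const)
  have hAsub : A ⊆ ZpstarPi p 2 := fun t ht i _ =>
    ⟨norm_pos_iff.mp ((zpow_pos hppos _).trans_le (ht i).1), (ht i).2⟩
  have hval : ∀ (a : ℝ) (s : ℚ_[p]), (p : ℝ) ^ (-l) ≤ ‖s‖ →
      (if 1 ≤ ‖s • x‖ then ENNReal.ofReal ‖s • x‖ ^ a else 0) =
        ENNReal.ofReal ‖s‖ ^ a * (p : ℝ≥0∞) ^ ((k : ℝ) * a) := by
    intro a s hs
    have hspos : 0 < ‖s‖ := (zpow_pos hppos _).trans_le hs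
    have h1 : 1 ≤ ‖s • x‖ := by
      rw [norm_smul, hx']
      calc (1 : ℝ) ≤ (p : ℝ) ^ (-l + k) :=
            one_le_zpow₀ (mod_cast (Fact.out : p.Prime).one_le) (by lia)
        _ = (p : ℝ) ^ (-l) * (p : ℝ) ^ k := zpow_add₀ hppos.ne' _ _
        _ ≤ _ := by gcongr
    rw [if_pos h1, norm_smul, hx', ENNReal.ofReal_mul (norm_nonneg _),
      ENNReal.mul_rpow_of_ne_top ENNReal.ofReal_ne_top ENNReal.ofReal_ne_top, hofReal,
      ← ENNReal.rpow_mul]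
  have hexp : -α - (n : ℝ) / q - 2 * ε =
      (-α₁ - (n : ℝ) / q₁ - ε) + (-α₂ - (n : ℝ) / q₂ - ε) := by
    rw [div_eq_mul_one_div (n : ℝ) q, hqs, hα]
    ring
  rw [← lintegral_const_mul' _ _ (hfin _)]
  refine le_trans (setLIntegral_mono' hAmeas fun t ht => le_of_eq ?_)
    (lintegral_mono_set hAsub)
  simp only [Fin.prod_univ_two, Matrix.cons_val_zero, Matrix.cons_val_one, hf₁, hf₂,
    hval _ _ (ht 0).1, hval _ _ (ht 1).1]
  rw [hexp, mul_add, ENNReal.rpow_add _ _ hp0 hptop]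
  ring

end
end

section
/- Let p be prime, n ≥ 1, let α ∈ ℝ, λ > 0, 1 < r, q < ∞, and set α₁ = α₂ = α/2, λ₁ = λ₂ = λ/2, q₁ = q₂ = 2q, r₁ = r₂ = 2r. Let ψ be a nonnegative measurable function on ℤ_p^* × ℤ_p^*, and define f_i on ℚ_p^n \ {0} by f_i(x) = |x|_p^{−(α_i+n/q_i−λ_i)} for i = 1, 2. Then ‖H^{p,2}_ψ(f₁,f₂)‖_{MK̇^{α,λ}_{r,q}} = ‖f₁‖_{MK̇^{α₁,λ₁}_{r₁,q₁}} · ‖f₂‖_{MK̇^{α₂,λ₂}_{r₂,q₂}} · ∫_{ℤ_p^*}∫_{ℤ_p^*} |t₁|_p^{−(α₁+n/q₁−λ₁)} |t₂|_p^{−(α₂+n/q₂−λ₂)} ψ(t₁,t₂) dt₁ dt₂. -/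
open MeasureTheory
open scoped ENNReal

noncomputable section

variable (p : ℕ) [Fact p.Prime]

/-- A point of a `p`-adic sphere is nonzero. -/
theorem ne_zero_of_mem_padicSphere {p n : ℕ} [Fact p.Prime] {k : ℤ} {x : Fin n → ℚ_[p]}
    (hx : x ∈ padicSphere p n k) : x ≠ 0 := by
  have hp : (0 : ℝ) < p := Nat.cast_pos.mpr (Fact.out : p.Prime).pos
  have h : ‖x‖ = (p : ℝ) ^ k := hx
  exact norm_pos_iff.mp (h ▸ zpow_pos hp k)

theorem measurableSet_ZpstarPi (p m : ℕ) [Fact p.Prime] : MeasurableSet (ZpstarPi p m) :=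
  MeasurableSet.univ_pi fun _ =>
    (measurableSet_singleton (0 : ℚ_[p])).compl.inter
      (isClosed_le continuous_norm continuous_const).measurableSet

/-- The bilinear Hardy operator maps a pair of powers of the norm to a multiple of a power. -/
theorem multilinearHardy_norm_rpow {p n : ℕ} [Fact p.Prime] (a b : ℝ)
    (ψ : (Fin 2 → ℚ_[p]) → ℝ≥0∞) {f g : (Fin n → ℚ_[p]) → ℝ≥0∞}
    (hf : ∀ x, x ≠ 0 → f x = ENNReal.ofReal ‖x‖ ^ a)
    (hg : ∀ x, x ≠ 0 → g x = ENNReal.ofReal ‖x‖ ^ b)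
    {x : Fin n → ℚ_[p]} (hx : x ≠ 0) :
    multilinearHardy p n 2 ψ ![f, g] x =
      ENNReal.ofReal ‖x‖ ^ a * ENNReal.ofReal ‖x‖ ^ b *
        ∫⁻ t in ZpstarPi p 2,
          ENNReal.ofReal ‖t 0‖ ^ a * ENNReal.ofReal ‖t 1‖ ^ b * ψ t ∂ padicHaarPi p 2 := by
  have hpos : ENNReal.ofReal ‖x‖ ≠ 0 := (ENNReal.ofReal_pos.mpr (norm_pos_iff.mpr hx)).ne'
  have hfin (c : ℝ) : ENNReal.ofReal ‖x‖ ^ c ≠ ⊤ :=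
    ENNReal.rpow_ne_top_of_ne_zero hpos ENNReal.ofReal_ne_top
  have hsmul {h : (Fin n → ℚ_[p]) → ℝ≥0∞} {c : ℝ}
      (hh : ∀ x, x ≠ 0 → h x = ENNReal.ofReal ‖x‖ ^ c) {s : ℚ_[p]} (hs : s ≠ 0) :
      h (s • x) = ENNReal.ofReal ‖s‖ ^ c * ENNReal.ofReal ‖x‖ ^ c := by
    rw [hh _ (smul_ne_zero hs hx), norm_smul, ENNReal.ofReal_mul (norm_nonneg _),
      ENNReal.mul_rpow_of_ne_top ENNReal.ofReal_ne_top ENNReal.ofReal_ne_top]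
  rw [multilinearHardy, ← lintegral_const_mul' _ _ (ENNReal.mul_ne_top (hfin a) (hfin b))]
  refine setLIntegral_congr_fun (measurableSet_ZpstarPi p 2) fun t ht => ?_
  have ht' (i : Fin 2) : t i ≠ 0 := (ht i (Set.mem_univ i)).1
  simp only [Fin.prod_univ_two, Matrix.cons_val_zero, Matrix.cons_val_one,
    hsmul hf (ht' 0), hsmul hg (ht' 1)]
  ring

/-- The `L^q` norm over a sphere of a function that is constant there. -/
theorem lqNormSphere_eq_of_forall_eq {p n : ℕ} [Fact p.Prime] {q : ℝ} (hq : 0 < q) {k : ℤ}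
    {f : (Fin n → ℚ_[p]) → ℝ≥0∞} {c : ℝ≥0∞} (hf : ∀ x ∈ padicSphere p n k, f x = c) :
    lqNormSphere p n q k f = c * padicHaarPi p n (padicSphere p n k) ^ (1 / q) := by
  rw [lqNormSphere, setLIntegral_congr_fun (g := fun _ => c ^ q) (measurableSet_padicSphere p n k)
      fun x hx => by simp only [hf x hx], setLIntegral_const,
    ENNReal.mul_rpow_of_nonneg _ _ (by positivity), ← ENNReal.rpow_mul, mul_one_div_cancel hq.ne',
    ENNReal.rpow_one]

/-- If, over every sphere, the `L^q` norm of `g` is a fixed multiple of the square of the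
`L^{2q}` norm of `f`, then the same holds for the Morrey–Herz norms with doubled exponents. -/
theorem morreyHerzNorm_eq_sq_mul {p n : ℕ} [Fact p.Prime] (α lam : ℝ) {r q : ℝ} (hr : 0 < r)
    {f g : (Fin n → ℚ_[p]) → ℝ≥0∞} {c : ℝ≥0∞}
    (h : ∀ k, lqNormSphere p n q k g = lqNormSphere p n (2 * q) k f ^ (2 : ℝ) * c) :
    morreyHerzNorm p n α lam r q g =
      morreyHerzNorm p n (α / 2) (lam / 2) (2 * r) (2 * q) f ^ (2 : ℝ) * c := by
  have hsup (u : ℤ → ℝ≥0∞) : (⨆ k, u k) ^ (2 : ℝ) = ⨆ k, u k ^ (2 : ℝ) :=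
    (ENNReal.orderIsoRpow 2 two_pos).map_iSup u
  rw [morreyHerzNorm, morreyHerzNorm, hsup, ENNReal.iSup_mul]
  refine iSup_congr fun k₀ => ?_
  have hterm (k : {k : ℤ // k ≤ k₀}) :
      (p : ℝ≥0∞) ^ (((k : ℤ) : ℝ) * α * r) * lqNormSphere p n q k g ^ r =
        (p : ℝ≥0∞) ^ (((k : ℤ) : ℝ) * (α / 2) * (2 * r)) *
          lqNormSphere p n (2 * q) k f ^ (2 * r) * c ^ r := by
    rw [h, ENNReal.mul_rpow_of_nonneg _ _ hr.le, ← ENNReal.rpow_mul, ← mul_assoc,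
      show ((k : ℤ) : ℝ) * (α / 2) * (2 * r) = ((k : ℤ) : ℝ) * α * r by ring]
  simp_rw [hterm]
  rw [ENNReal.tsum_mul_right, ENNReal.mul_rpow_of_nonneg _ _ (by positivity),
    ENNReal.mul_rpow_of_nonneg _ _ (by positivity), ← ENNReal.rpow_mul, ← ENNReal.rpow_mul,
    ← ENNReal.rpow_mul, mul_one_div_cancel hr.ne', ENNReal.rpow_one,
    show 1 / (2 * r) * 2 = 1 / r by field_simp,
    show -(k₀ : ℝ) * (lam / 2) * 2 = -(k₀ : ℝ) * lam by ring, mul_assoc]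

/-- The extremal equality in the necessity part of Theorem 3.1 (case `m = 2`):
for the power test functions, the Morrey–Herz norm of `H^{p,2}_ψ(f₁,f₂)` equals the
product of the norms of `f₁, f₂` times the weight integral. -/
theorem statement14 (p n : ℕ) [Fact p.Prime] (hn : 1 ≤ n)
    (α lam r q : ℝ) (hlam : 0 < lam) (hr : 1 < r) (hq : 1 < q)
    (ψ : (Fin 2 → ℚ_[p]) → ℝ≥0∞) (hψ : Measurable ψ)
    (f₁ f₂ : (Fin n → ℚ_[p]) → ℝ≥0∞)
    (hf₁ : ∀ x : Fin n → ℚ_[p], x ≠ 0 →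
        f₁ x = ENNReal.ofReal ‖x‖ ^ (-(α / 2 + (n : ℝ) / (2 * q) - lam / 2)))
    (hf₂ : ∀ x : Fin n → ℚ_[p], x ≠ 0 →
        f₂ x = ENNReal.ofReal ‖x‖ ^ (-(α / 2 + (n : ℝ) / (2 * q) - lam / 2))) :
    morreyHerzNorm p n α lam r q (multilinearHardy p n 2 ψ ![f₁, f₂])
      = morreyHerzNorm p n (α / 2) (lam / 2) (2 * r) (2 * q) f₁ *
          morreyHerzNorm p n (α / 2) (lam / 2) (2 * r) (2 * q) f₂ *
          ∫⁻ t in ZpstarPi p 2,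
            ENNReal.ofReal ‖t 0‖ ^ (-(α / 2 + (n : ℝ) / (2 * q) - lam / 2)) *
              ENNReal.ofReal ‖t 1‖ ^ (-(α / 2 + (n : ℝ) / (2 * q) - lam / 2)) * ψ t
            ∂ padicHaarPi p 2 := by
  set β : ℝ := -(α / 2 + (n : ℝ) / (2 * q) - lam / 2)
  set I : ℝ≥0∞ := ∫⁻ t in ZpstarPi p 2,
    ENNReal.ofReal ‖t 0‖ ^ β * ENNReal.ofReal ‖t 1‖ ^ β * ψ t ∂ padicHaarPi p 2 with hI
  have hq0 : 0 < q := one_pos.trans hq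
  have hsphere {f : (Fin n → ℚ_[p]) → ℝ≥0∞} (hf : ∀ x, x ≠ 0 → f x = ENNReal.ofReal ‖x‖ ^ β)
      (k : ℤ) : lqNormSphere p n (2 * q) k f =
        ENNReal.ofReal ((p : ℝ) ^ k) ^ β *
          padicHaarPi p n (padicSphere p n k) ^ (1 / (2 * q)) :=
    lqNormSphere_eq_of_forall_eq (by positivity) fun x hx => by
      rw [hf x (ne_zero_of_mem_padicSphere hx), show ‖x‖ = (p : ℝ) ^ k from hx]
  have hf₂₁ : morreyHerzNorm p n (α / 2) (lam / 2) (2 * r) (2 * q) f₂ =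
      morreyHerzNorm p n (α / 2) (lam / 2) (2 * r) (2 * q) f₁ := by
    simp only [morreyHerzNorm, hsphere hf₁, hsphere hf₂]
  rw [hf₂₁, ← pow_two, ← ENNReal.rpow_two]
  refine morreyHerzNorm_eq_sq_mul α lam (one_pos.trans hr) fun k => ?_
  rw [hsphere hf₁, lqNormSphere_eq_of_forall_eq hq0
      (c := ENNReal.ofReal ((p : ℝ) ^ k) ^ β * ENNReal.ofReal ((p : ℝ) ^ k) ^ β * I)
      fun x hx => by
        rw [multilinearHardy_norm_rpow β β ψ hf₁ hf₂ (ne_zero_of_mem_padicSphere hx),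
          show ‖x‖ = (p : ℝ) ^ k from hx],
    ENNReal.mul_rpow_of_nonneg _ _ zero_le_two, ENNReal.rpow_two, pow_two, ← ENNReal.rpow_mul,
    show 1 / (2 * q) * 2 = 1 / q by field_simp]
  ring

end
end
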